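/- Let p and q be prime numbers with q = p + 2 and p ≡ 3 (mod 4), and let a, b be integers with a² + b² = q. Let L be a field equipped with a ℚ₂-algebra structure such that L has dimension 2 as a ℚ₂-vector space, let α ∈ L satisfy α² = -1, and set μ = a + b·α ∈ L. Then there exist z, w ∈ L with μ·w² = μ² - (p+q)·μ·z² + pq·z⁴ if and only if p ≡ 7 (mod 8) or a ≡ 2 (mod 4). -/

import Mathlib

theorem aux_coe (x : ℤ_[2]) : (x : ℚ_[2]) = PadicInt.Coe.ringHom x := rfl

theorem aux_coe_inj (x y : ℤ_[2]) (h : PadicInt.Coe.ringHom x = PadicInt.Coe.ringHom y) :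
    x = y := Subtype.ext h

theorem aux_hensel (x m : ℤ) (h : (8:ℤ) ∣ x + 4 * m ^ 2 - 1) :
    ∃ s : ℚ_[2], s ≠ 0 ∧ s ^ 4 - x * s ^ 2 - 4 * m ^ 2 = 0 := by
  let F : Polynomial ℤ_[2] := Polynomial.X ^ 4 - Polynomial.C (x : ℤ_[2]) * Polynomial.X ^ 2
    - Polynomial.C (4 * (m : ℤ_[2]) ^ 2)
  have e1 : F.aeval (1 : ℤ_[2]) = ((-(x + 4 * m ^ 2 - 1) : ℤ) : ℤ_[2]) := by
    simp [F]; ring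
  have e2 : F.derivative.aeval (1 : ℤ_[2]) = ((2 * (2 - x) : ℤ) : ℤ_[2]) := by
    simp only [F, Polynomial.derivative_sub, Polynomial.derivative_C_mul, Polynomial.derivative_C, Polynomial.derivative_X_pow]
    simp; ring
  have n1 : ‖F.aeval (1 : ℤ_[2])‖ ≤ 1 / 8 := by
    rw [e1]
    have := (PadicInt.norm_int_le_pow_iff_dvd (p := 2) (k := -(x + 4 * m ^ 2 - 1)) (n := 3)).2
      (dvd_neg.2 (by exact_mod_cast h))
    refine this.trans ?_
    norm_num
  have hodd : ¬ ((2:ℤ) ∣ 2 - x) := by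
    intro h2
    have : (2:ℤ) ∣ x + 4 * m ^ 2 - 1 := dvd_trans (by norm_num) h
    have h4 : (2:ℤ) ∣ 4 * m ^ 2 := ⟨2 * m ^ 2, by ring⟩
    omega
  have n2 : ‖F.derivative.aeval (1 : ℤ_[2])‖ = 1 / 2 := by
    rw [e2]
    have h1 : ‖((2 - x : ℤ) : ℤ_[2])‖ = 1 := by
      apply le_antisymm (PadicInt.norm_le_one _)
      by_contra hlt
      exact hodd (by exact_mod_cast (PadicInt.norm_int_lt_one_iff_dvd (p := 2) _).1 (not_le.1 hlt))
    have h2 : ‖((2 : ℤ) : ℤ_[2])‖ = 1 / 2 := by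
      have := PadicInt.norm_p (p := 2)
      norm_num at this ⊢
      exact this
    rw [Int.cast_mul, norm_mul, h1, h2]; norm_num
  obtain ⟨s, hs, hs1, -⟩ := hensels_lemma (p := 2) (R := ℤ_[2]) (F := F) (a := 1) (by rw [n2]; linarith)
  refine ⟨(s : ℚ_[2]), ?_, ?_⟩
  · intro h0
    have : s = 0 := Subtype.ext h0
    rw [this, n2] at hs1
    norm_num at hs1
  · have : s ^ 4 - x * s ^ 2 - 4 * m ^ 2 = 0 := by simpa [F] using hs
    have h3 := congrArg (PadicInt.Coe.ringHom (p := 2)) this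
    simp only [map_add, map_sub, map_mul, map_pow, map_intCast, map_ofNat, map_zero] at h3
    exact h3

theorem aux_sq (L : Type*) [Field L] [Algebra ℚ_[2] L] (α : L) (hα : α ^ 2 = -1) (x m : ℤ)
    (h : (8:ℤ) ∣ x + 4 * m ^ 2 - 1 ∨ (8:ℤ) ∣ -x + 4 * m ^ 2 - 1) :
    ∃ s : L, s ^ 2 = (x : L) + ((4 * m : ℤ) : L) * α := by
  have key : ∀ x m : ℤ, (8:ℤ) ∣ x + 4 * m ^ 2 - 1 →
      ∃ s : L, s ^ 2 = (x : L) + ((4 * m : ℤ) : L) * α := by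
    intro x m h
    obtain ⟨s, hs0, hs⟩ := aux_hensel x m h
    have h3 := congrArg (algebraMap ℚ_[2] L) hs
    have hS0 : algebraMap ℚ_[2] L s ≠ 0 := by simpa using hs0
    simp only [map_sub, map_mul, map_pow, map_intCast, map_ofNat, map_zero] at h3
    generalize algebraMap ℚ_[2] L s = S at *
    refine ⟨S + 2 * m / S * α, ?_⟩
    push_cast
    field_simp
    linear_combination h3 + 4 * (m:L) ^ 2 * hα
  rcases h with h | h
  · exact key x m h
  · obtain ⟨s, hs⟩ := key (-x) (-m) (by simpa using h)
    refine ⟨s * α, ?_⟩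
    push_cast at hs ⊢
    linear_combination α ^ 2 * hs + (-(x:L) - 4 * m * α) * hα

theorem aux_one_add_sq (u : ℚ_[2]) (hu : ‖u‖ ≤ 1) : 1 / 2 ≤ ‖1 + u ^ 2‖ := by
  by_contra hlt
  push Not at hlt
  let v : ℤ_[2] := ⟨u, hu⟩
  have h1 : ‖1 + v ^ 2‖ < 1 / 2 := by
    have : ‖1 + v ^ 2‖ = ‖1 + u ^ 2‖ := by
      rw [PadicInt.norm_def, aux_coe]; simp only [map_add, map_one, map_pow]; rfl
    rw [this]; exact hlt
  have h2 : ‖1 + v ^ 2‖ ≤ (2:ℕ) ^ (-(2:ℕ) : ℤ) := by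
    rw [PadicInt.norm_le_pow_iff_norm_lt_pow_add_one]
    norm_num at h1 ⊢
    exact h1
  rw [PadicInt.norm_le_pow_iff_mem_span_pow] at h2
  rw [← PadicInt.ker_toZModPow, RingHom.mem_ker] at h2
  simp only [map_add, map_one, map_pow] at h2
  generalize PadicInt.toZModPow 2 v = t at h2
  revert t
  decide

theorem aux_norm_aux (x y : ℚ_[2]) (hxy : ‖y‖ ≤ ‖x‖) (h : ‖x ^ 2 + y ^ 2‖ ≤ 1) : ‖x‖ ≤ 1 := by
  by_contra hx
  push Not at hx
  have hx0 : x ≠ 0 := by rintro rfl; simp at hx; linarith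
  have h1 := aux_one_add_sq (y / x) (by
    rw [norm_div]; exact div_le_one_of_le₀ hxy (norm_nonneg _))
  have h2 : x ^ 2 + y ^ 2 = x ^ 2 * (1 + (y / x) ^ 2) := by field_simp
  rw [h2, norm_mul, norm_pow] at h
  have h3 : 2 ≤ ‖x‖ := by
    by_contra h4
    push Not at h4
    have := (Padic.norm_le_pow_iff_norm_lt_pow_add_one x 0).2 (by norm_num; exact h4)
    norm_num at this
    linarith
  nlinarith

theorem aux_norm (x y : ℚ_[2]) (h : ‖x ^ 2 + y ^ 2‖ ≤ 1) : ‖x‖ ≤ 1 ∧ ‖y‖ ≤ 1 := by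
  rcases le_total ‖y‖ ‖x‖ with h1 | h1
  · have := aux_norm_aux x y h1 h
    exact ⟨this, h1.trans this⟩
  · have := aux_norm_aux y x h1 (by rwa [add_comm])
    exact ⟨h1.trans this, this⟩

theorem aux_inj (L : Type*) [Field L] [Algebra ℚ_[2] L] (α : L) (hα : α ^ 2 = -1) (x y : ℚ_[2])
    (h : algebraMap ℚ_[2] L x + algebraMap ℚ_[2] L y * α = 0) : x = 0 ∧ y = 0 := by
  have h1 : x ^ 2 + y ^ 2 = 0 := by
    have : algebraMap ℚ_[2] L (x ^ 2 + y ^ 2) = 0 := by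
      simp only [map_add, map_pow]
      linear_combination (algebraMap ℚ_[2] L x - algebraMap ℚ_[2] L y * α) * h
        + (algebraMap ℚ_[2] L y) ^ 2 * hα
    exact (map_eq_zero _).1 this
  have hy : y = 0 := by
    by_contra hy
    have h2 : 1 + (x / y) ^ 2 = 0 := by field_simp; linear_combination h1
    have h3 : ‖(x / y)‖ ^ 2 = 1 := by
      rw [← norm_pow, show (x / y) ^ 2 = -1 by linear_combination h2]; simp
    have := aux_one_add_sq (x / y) (by nlinarith [norm_nonneg (x / y)])
    rw [h2] at this
    norm_num at this
  subst hy
  simp at h1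
  exact ⟨h1, rfl⟩

theorem aux_span (L : Type*) [Field L] [Algebra ℚ_[2] L] (hdim : Module.finrank ℚ_[2] L = 2)
    (α : L) (hα : α ^ 2 = -1) (z : L) :
    ∃ x y : ℚ_[2], z = algebraMap ℚ_[2] L x + algebraMap ℚ_[2] L y * α := by
  have hli : LinearIndependent ℚ_[2] ![(1 : L), α] := by
    rw [LinearIndependent.pair_iff]
    intro s t hst
    apply aux_inj L α hα
    simpa [Algebra.smul_def] using hst
  have hsp := hli.span_eq_top_of_card_eq_finrank (by simp [hdim])
  have hz : z ∈ Submodule.span ℚ_[2] (Set.range ![(1 : L), α]) := by rw [hsp]; trivial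
  simp only [Matrix.range_cons, Matrix.range_empty, Set.union_empty, Set.singleton_union] at hz
  obtain ⟨x, y, h⟩ := Submodule.mem_span_pair.1 hz
  exact ⟨x, y, by rw [← h]; simp [Algebra.smul_def]⟩

theorem aux_pow4 : ∀ x y : ZMod (2 ^ 3), 
    ((2 * (x ^ 2 - y ^ 2) * (2 * x * y)) = 0) ∧ 
    ((x ^ 2 - y ^ 2) ^ 2 - (2 * x * y) ^ 2 = 0 ∨ (x ^ 2 - y ^ 2) ^ 2 - (2 * x * y) ^ 2 = 1 ∨
      (x ^ 2 - y ^ 2) ^ 2 - (2 * x * y) ^ 2 = 4) := by decide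

theorem aux_fin : ∀ a b : ZMod (2 ^ 3), 4 * a = 4 → 2 * b = 4 → ∀ w v : ZMod (2 ^ 3), 
    ∀ T ∈ [(0 : ZMod (2 ^ 3)), 1, 4], ∀ Z ∈ [(0 : ZMod (2 ^ 3)), 1, 4], (Z = 1 ∨ T = 1) → 
    a * (w ^ 2 - v ^ 2) - b * (2 * w * v) = (a ^ 2 - b ^ 2) * T - Z →
    a * (2 * w * v) + b * (w ^ 2 - v ^ 2) = 2 * a * b * T → False := by
  decide

/-- Integral elements of `L`. -/
def AuxInt (L : Type*) [Field L] [Algebra ℚ_[2] L] (α : L) (z : L) : Prop :=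
  ∃ x y : ℤ_[2], z = algebraMap ℚ_[2] L x + algebraMap ℚ_[2] L y * α

theorem aux_int_or (L : Type*) [Field L] [Algebra ℚ_[2] L] (hdim : Module.finrank ℚ_[2] L = 2)
    (α : L) (hα : α ^ 2 = -1) (z : L) : AuxInt L α z ∨ (z ≠ 0 ∧ AuxInt L α z⁻¹) := by
  obtain ⟨x, y, rfl⟩ := aux_span L hdim α hα z
  by_cases h : ‖x ^ 2 + y ^ 2‖ ≤ 1
  · obtain ⟨h1, h2⟩ := aux_norm x y h
    exact Or.inl ⟨⟨x, h1⟩, ⟨y, h2⟩, rfl⟩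
  · right
    push Not at h
    have hN : x ^ 2 + y ^ 2 ≠ 0 := by intro h0; rw [h0] at h; norm_num at h
    have hN' : (algebraMap ℚ_[2] L x) ^ 2 + (algebraMap ℚ_[2] L y) ^ 2 ≠ 0 := by
      rw [← map_pow, ← map_pow, ← map_add]; exact (map_ne_zero _).2 hN
    have hz : algebraMap ℚ_[2] L x + algebraMap ℚ_[2] L y * α ≠ 0 := by
      intro h0
      obtain ⟨rfl, rfl⟩ := aux_inj L α hα x y h0
      simp at hN
    refine ⟨hz, ?_⟩
    obtain ⟨h1, h2⟩ := aux_norm (x / (x ^ 2 + y ^ 2)) (-y / (x ^ 2 + y ^ 2)) (by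
      have : (x / (x ^ 2 + y ^ 2)) ^ 2 + (-y / (x ^ 2 + y ^ 2)) ^ 2 = (x ^ 2 + y ^ 2)⁻¹ := by
        field_simp
      rw [this, norm_inv]
      exact inv_le_one_of_one_le₀ h.le)
    refine ⟨⟨_, h1⟩, ⟨_, h2⟩, ?_⟩
    apply inv_eq_of_mul_eq_one_right
    simp only [map_div₀, map_neg, map_add, map_pow]
    field_simp
    linear_combination -(algebraMap ℚ_[2] L y) ^ 2 * hα

theorem aux_nonex (p q : ℕ) (hpq : q = p + 2)
    (hp3 : p % 8 = 3) (a b : ℤ) (ha : a % 2 = 1) (hb : b % 4 = 2) (hab : a ^ 2 + b ^ 2 = (q : ℤ))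
    (L : Type*) [Field L] [Algebra ℚ_[2] L] (hdim : Module.finrank ℚ_[2] L = 2)
    (α : L) (hα : α ^ 2 = -1) (z t w : L) (hz : AuxInt L α z) (ht : AuxInt L α t)
    (hzt : z = 1 ∨ t = 1)
    (h : ((a:L) + b * α) * w ^ 2 = ((a:L) + b * α) ^ 2 * t ^ 4
      - ((p : L) + (q : L)) * ((a:L) + b * α) * z ^ 2 * t ^ 2 + (p : L) * (q : L) * z ^ 4) :
    False := by
  obtain ⟨x, y, hz⟩ := hz
  obtain ⟨r, s, ht⟩ := ht
  obtain ⟨W, V, hw⟩ := aux_span L hdim α hα w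
  -- coordinates of the right-hand side
  let R1 : ℤ_[2] := (a ^ 2 - b ^ 2) * ((r ^ 2 - s ^ 2) ^ 2 - (2 * r * s) ^ 2)
    - 2 * a * b * (2 * (r ^ 2 - s ^ 2) * (2 * r * s))
    - (p + q) * (a * ((x ^ 2 - y ^ 2) * (r ^ 2 - s ^ 2) - (2 * x * y) * (2 * r * s))
      - b * ((x ^ 2 - y ^ 2) * (2 * r * s) + (2 * x * y) * (r ^ 2 - s ^ 2)))
    + p * q * ((x ^ 2 - y ^ 2) ^ 2 - (2 * x * y) ^ 2)
  let R2 : ℤ_[2] := (a ^ 2 - b ^ 2) * (2 * (r ^ 2 - s ^ 2) * (2 * r * s))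
    + 2 * a * b * ((r ^ 2 - s ^ 2) ^ 2 - (2 * r * s) ^ 2)
    - (p + q) * (b * ((x ^ 2 - y ^ 2) * (r ^ 2 - s ^ 2) - (2 * x * y) * (2 * r * s))
      + a * ((x ^ 2 - y ^ 2) * (2 * r * s) + (2 * x * y) * (r ^ 2 - s ^ 2)))
    + p * q * (2 * (x ^ 2 - y ^ 2) * (2 * x * y))
  have hα3 : α ^ 3 = -α := by linear_combination α * hα
  have hα4 : α ^ 4 = 1 := by linear_combination (α ^ 2 - 1) * hα
  have hα5 : α ^ 5 = α := by linear_combination α * (α ^ 2 - 1) * hα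
  have hα6 : α ^ 6 = -1 := by linear_combination (α ^ 4 - α ^ 2 + 1) * hα
  have hcoord := aux_inj L α hα
    ((a * (W ^ 2 - V ^ 2) - b * (2 * W * V)) - R1) ((a * (2 * W * V) + b * (W ^ 2 - V ^ 2)) - R2)
    (by
      rw [hw, hz, ht] at h
      clear hz ht hw
      simp only [aux_coe] at h ⊢
      simp only [R1, R2]
      simp only [map_add, map_sub, map_mul, map_pow, map_intCast, map_natCast, map_ofNat]
      generalize algebraMap ℚ_[2] L (PadicInt.Coe.ringHom x) = x' at *
      generalize algebraMap ℚ_[2] L (PadicInt.Coe.ringHom y) = y' at *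
      generalize algebraMap ℚ_[2] L (PadicInt.Coe.ringHom r) = r' at *
      generalize algebraMap ℚ_[2] L (PadicInt.Coe.ringHom s) = s' at *
      generalize algebraMap ℚ_[2] L W = W' at *
      generalize algebraMap ℚ_[2] L V = V' at *
      rw [← sub_eq_zero] at h
      rw [← h]
      ring_nf
      simp only [hα, hα3, hα4, hα5, hα6]
      ring)
  obtain ⟨h1, h2⟩ := hcoord
  have hqn : ‖(q : ℚ_[2])‖ = 1 := by
    apply le_antisymm (by exact_mod_cast Padic.norm_int_le_one (q : ℤ))
    by_contra hlt
    push Not at hlt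
    have : (2:ℤ) ∣ q := by
      have := (Padic.norm_intCast_lt_one_iff (p := 2) (k := (q : ℤ))).1 (by exact_mod_cast hlt)
      exact_mod_cast this
    omega
  have habQ : (a : ℚ_[2]) ^ 2 + (b : ℚ_[2]) ^ 2 = q := by exact_mod_cast hab
  have hN : (q : ℚ_[2]) * (W ^ 2 + V ^ 2) ^ 2 = (R1 ^ 2 + R2 ^ 2 : ℤ_[2]) := by
    rw [PadicInt.coe_add, PadicInt.coe_pow, PadicInt.coe_pow]
    have e1 : (R1 : ℚ_[2]) = (a * (W ^ 2 - V ^ 2) - b * (2 * W * V)) := by linear_combination -h1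
    have e2 : (R2 : ℚ_[2]) = (a * (2 * W * V) + b * (W ^ 2 - V ^ 2)) := by linear_combination -h2
    rw [e1, e2, ← habQ]
    ring
  have hWV : ‖W ^ 2 + V ^ 2‖ ≤ 1 := by
    have h3 := congrArg norm hN
    rw [norm_mul, hqn, one_mul, norm_pow] at h3
    have h4 : ‖((R1 ^ 2 + R2 ^ 2 : ℤ_[2]) : ℚ_[2])‖ ≤ 1 := PadicInt.norm_le_one _
    rw [← h3] at h4
    nlinarith [norm_nonneg (W ^ 2 + V ^ 2)]
  obtain ⟨hW, hV⟩ := aux_norm W V hWV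
  obtain ⟨W, rfl⟩ : ∃ W' : ℤ_[2], W = (W' : ℚ_[2]) := ⟨⟨W, hW⟩, rfl⟩
  obtain ⟨V, rfl⟩ : ∃ W' : ℤ_[2], V = (W' : ℚ_[2]) := ⟨⟨V, hV⟩, rfl⟩
  have g1 : (a * (W ^ 2 - V ^ 2) - b * (2 * W * V)) - R1 = 0 := by
    apply aux_coe_inj
    simp only [map_add, map_sub, map_mul, map_pow, map_intCast, map_ofNat, map_zero]
    exact h1
  have g2 : (a * (2 * W * V) + b * (W ^ 2 - V ^ 2)) - R2 = 0 := by
    apply aux_coe_inj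
    simp only [map_add, map_sub, map_mul, map_pow, map_intCast, map_ofNat, map_zero]
    exact h2
  have k1 := congrArg (PadicInt.toZModPow (p := 2) 3) g1
  have k2 := congrArg (PadicInt.toZModPow (p := 2) 3) g2
  simp only [R1, R2, map_add, map_sub, map_mul, map_pow, map_intCast, map_natCast, map_ofNat,
    map_zero] at k1 k2
  have hpqs : ((p : ZMod (2 ^ 3)) + q) = 0 := by
    have : ((p + q : ℕ) : ZMod (2 ^ 3)) = 0 := by
      rw [ZMod.natCast_eq_zero_iff]; norm_num; omega
    exact_mod_cast this
  have hpp : (p : ZMod (2 ^ 3)) = 3 := by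
    have : ((p : ℕ) : ZMod (2 ^ 3)) = ((3 : ℕ) : ZMod (2 ^ 3)) := by
      rw [ZMod.natCast_eq_natCast_iff']; norm_num; omega
    exact_mod_cast this
  have hpqm : (p : ZMod (2 ^ 3)) * q = -1 := by
    rw [hpq]; push_cast; rw [hpp]; decide
  have ha' : 4 * (a : ZMod (2 ^ 3)) = 4 := by
    have : ((4 * a - 4 : ℤ) : ZMod (2 ^ 3)) = 0 := by
      rw [ZMod.intCast_zmod_eq_zero_iff_dvd]; norm_num; omega
    push_cast at this
    linear_combination this
  have hb' : 2 * (b : ZMod (2 ^ 3)) = 4 := by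
    have : ((2 * b - 4 : ℤ) : ZMod (2 ^ 3)) = 0 := by
      rw [ZMod.intCast_zmod_eq_zero_iff_dvd]; norm_num; omega
    push_cast at this
    linear_combination this
  have hone : ∀ (u v : ℤ_[2]), (1:L) = algebraMap ℚ_[2] L u + algebraMap ℚ_[2] L v * α →
      u = 1 ∧ v = 0 := by
    intro u v huv
    obtain ⟨h5, h6⟩ := aux_inj L α hα (u - 1) v (by
      rw [map_sub, map_one]; linear_combination -huv)
    constructor
    · have : (u : ℚ_[2]) = 1 := by linear_combination h5
      exact Subtype.ext this
    · exact Subtype.ext h6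
  have hc : (PadicInt.toZModPow (p := 2) 3 x = 1 ∧ PadicInt.toZModPow (p := 2) 3 y = 0) ∨
      (PadicInt.toZModPow (p := 2) 3 r = 1 ∧ PadicInt.toZModPow (p := 2) 3 s = 0) := by
    rcases hzt with h0 | h0
    · obtain ⟨rfl, rfl⟩ := hone x y (by rw [← hz, h0])
      left; simp
    · obtain ⟨rfl, rfl⟩ := hone r s (by rw [← ht, h0])
      right; simp
  rw [hpqs, hpqm] at k1 k2
  generalize PadicInt.toZModPow (p := 2) 3 x = x' at *
  generalize PadicInt.toZModPow (p := 2) 3 y = y' at *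
  generalize PadicInt.toZModPow (p := 2) 3 r = r' at *
  generalize PadicInt.toZModPow (p := 2) 3 s = s' at *
  generalize PadicInt.toZModPow (p := 2) 3 W = W' at *
  generalize PadicInt.toZModPow (p := 2) 3 V = V' at *
  obtain ⟨z1, z2⟩ := aux_pow4 x' y'
  obtain ⟨t1, t2⟩ := aux_pow4 r' s'
  refine aux_fin a b ha' hb' W' V' ((r' ^ 2 - s' ^ 2) ^ 2 - (2 * r' * s') ^ 2) (by simpa using t2)
    ((x' ^ 2 - y' ^ 2) ^ 2 - (2 * x' * y') ^ 2) (by simpa using z2) ?_ ?_ ?_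
  · rcases hc with ⟨rfl, rfl⟩ | ⟨rfl, rfl⟩
    · left; ring
    · right; ring
  · linear_combination k1 - 2 * a * b * t1
  · linear_combination k2 + (a ^ 2 - b ^ 2) * t1 - z1

theorem aux_A : ∀ a m k : ZMod 8, 4 * a = 4 →
    (a + 4 * m ^ 2 - 1 = 0 ∨ -a + 4 * m ^ 2 - 1 = 0) ∨
    ((4 * (a ^ 3 - 3 * a * (4 * m) ^ 2) + 2 * (16 * k + 16) * (-2 * a * (4 * m))
      - (8 * k + 7) * (8 * k + 9) * a) + 4 * (3 * a ^ 2 * (4 * m) - (4 * m) ^ 3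
      + (8 * k + 8) * (a ^ 2 - (4 * m) ^ 2) - (8 * k + 7) * (8 * k + 9) * m) ^ 2 - 1 = 0 ∨
    -(4 * (a ^ 3 - 3 * a * (4 * m) ^ 2) + 2 * (16 * k + 16) * (-2 * a * (4 * m))
      - (8 * k + 7) * (8 * k + 9) * a) + 4 * (3 * a ^ 2 * (4 * m) - (4 * m) ^ 3
      + (8 * k + 8) * (a ^ 2 - (4 * m) ^ 2) - (8 * k + 7) * (8 * k + 9) * m) ^ 2 - 1 = 0) := by
  decide

theorem aux_B : ∀ c n j : ZMod 8, c ^ 2 + n ^ 2 + n = j + 1 →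
    (((2 * n + 1) * (6 * c ^ 2 - 2 * n ^ 2 - 2 * n + 8 * j ^ 2 + 16 * j + 7)
      - 2 * c * (2 * n + 1) * (8 * j + 8)) + 4 * (-(c * (c ^ 2 - 3 * n ^ 2 - 3 * n + 4 * j ^ 2 + 8 * j + 3)
      - (j + 1) * (4 * c ^ 2 - (2 * n + 1) ^ 2))) ^ 2 - 1 = 0 ∨
    -((2 * n + 1) * (6 * c ^ 2 - 2 * n ^ 2 - 2 * n + 8 * j ^ 2 + 16 * j + 7)
      - 2 * c * (2 * n + 1) * (8 * j + 8)) + 4 * (-(c * (c ^ 2 - 3 * n ^ 2 - 3 * n + 4 * j ^ 2 + 8 * j + 3)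
      - (j + 1) * (4 * c ^ 2 - (2 * n + 1) ^ 2))) ^ 2 - 1 = 0) := by
  decide

theorem aux_dvd8 (x : ℤ) : (8:ℤ) ∣ x ↔ ((x : ℤ) : ZMod 8) = 0 := by
  rw [ZMod.intCast_zmod_eq_zero_iff_dvd]; norm_num

theorem aux_exA (L : Type*) [Field L] [Algebra ℚ_[2] L] (α : L) (hα : α ^ 2 = -1)
    (a m k : ℤ) (ha : a % 2 = 1) (hμ0 : (a : L) + ((4 * m : ℤ) : L) * α ≠ 0) (h2 : (2 : L) ≠ 0) :
    ∃ z w : L, ((a : L) + ((4 * m : ℤ) : L) * α) * w ^ 2 = ((a : L) + ((4 * m : ℤ) : L) * α) ^ 2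
      - ((8 * k + 7 : L) + (8 * k + 9)) * ((a : L) + ((4 * m : ℤ) : L) * α) * z ^ 2
      + (8 * k + 7) * (8 * k + 9) * z ^ 4 := by
  have h4 : 4 * (a : ZMod 8) = 4 := by
    have : ((4 * a - 4 : ℤ) : ZMod 8) = 0 := by
      rw [← aux_dvd8]; omega
    push_cast at this
    linear_combination this
  rcases aux_A a m k h4 with h | h
  · obtain ⟨s, hs⟩ := aux_sq L α hα a m (by
      rw [aux_dvd8, aux_dvd8]; push_cast; exact h)
    exact ⟨0, s, by rw [hs]; ring⟩
  · obtain ⟨s, hs⟩ := aux_sq L α hα (4 * (a ^ 3 - 3 * a * (4 * m) ^ 2)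
      + 2 * (16 * k + 16) * (-2 * a * (4 * m)) - (8 * k + 7) * (8 * k + 9) * a)
      (3 * a ^ 2 * (4 * m) - (4 * m) ^ 3
      + (8 * k + 8) * (a ^ 2 - (4 * m) ^ 2) - (8 * k + 7) * (8 * k + 9) * m) (by
      rw [aux_dvd8, aux_dvd8]; push_cast; exact h)
    refine ⟨(1 - α) / 2, s / (2 * ((a : L) + ((4 * m : ℤ) : L) * α)), ?_⟩
    rw [div_pow, hs]
    have hz2 : ((1 - α) / 2) ^ 2 = -α / 2 := by
      field_simp; linear_combination hα
    have hz4 : ((1 - α) / 2) ^ 4 = -1 / 4 := by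
      rw [show ((1 - α) / 2) ^ 4 = (((1 - α) / 2) ^ 2) ^ 2 by ring, hz2, div_pow, neg_sq, hα]
      norm_num
    rw [hz2, hz4]
    have h44 : (4:L) ≠ 0 := by
      rw [show (4:L) = 2 * 2 by norm_num]; exact mul_ne_zero h2 h2
    have hα3 : α ^ 3 = -α := by linear_combination α * hα
    rw [mul_pow (2 : L), mul_div_assoc', div_eq_iff (mul_ne_zero (pow_ne_zero _ h2) (pow_ne_zero _ hμ0))]
    rw [← sub_eq_zero]
    push_cast
    field_simp
    ring_nf
    have hα4 : α ^ 4 = 1 := by linear_combination (α ^ 2 - 1) * hα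
    simp only [hα, hα3, hα4]
    ring

theorem aux_exB (L : Type*) [Field L] [Algebra ℚ_[2] L] (α : L) (hα : α ^ 2 = -1)
    (c n j : ℤ) (hj : c ^ 2 + n ^ 2 + n = j + 1)
    (hμ0 : ((2 * c : ℤ) : L) + ((2 * n + 1 : ℤ) : L) * α ≠ 0) :
    ∃ z w : L, (((2 * c : ℤ) : L) + ((2 * n + 1 : ℤ) : L) * α) * w ^ 2
      = (((2 * c : ℤ) : L) + ((2 * n + 1 : ℤ) : L) * α) ^ 2
      - ((4 * j + 3 : L) + (4 * j + 5)) * (((2 * c : ℤ) : L) + ((2 * n + 1 : ℤ) : L) * α) * z ^ 2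
      + (4 * j + 3) * (4 * j + 5) * z ^ 4 := by
  have hj' : (c : ZMod 8) ^ 2 + n ^ 2 + n = j + 1 := by exact_mod_cast congrArg (Int.cast : ℤ → ZMod 8) hj
  obtain ⟨s, hs⟩ := aux_sq L α hα
    ((2 * n + 1) * (6 * c ^ 2 - 2 * n ^ 2 - 2 * n + 8 * j ^ 2 + 16 * j + 7)
      - 2 * c * (2 * n + 1) * (8 * j + 8))
    (-(c * (c ^ 2 - 3 * n ^ 2 - 3 * n + 4 * j ^ 2 + 8 * j + 3)
      - (j + 1) * (4 * c ^ 2 - (2 * n + 1) ^ 2))) (by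
    rw [aux_dvd8, aux_dvd8]; push_cast; exact aux_B c n j hj')
  refine ⟨1, (1 + α) * s / (((2 * c : ℤ) : L) + ((2 * n + 1 : ℤ) : L) * α), ?_⟩
  rw [div_pow, mul_pow, hs, show (1 + α) ^ 2 = 2 * α by linear_combination hα]
  have hα3 : α ^ 3 = -α := by linear_combination α * hα
  have hα4 : α ^ 4 = 1 := by linear_combination (α ^ 2 - 1) * hα
  rw [mul_div_assoc', div_eq_iff (pow_ne_zero _ hμ0), ← sub_eq_zero]
  push_cast
  ring_nf
  simp only [hα, hα3, hα4]
  ring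


/-- Let `p` and `q` be primes with `q = p + 2` and `p ≡ 3 (mod 4)`, and `a, b ∈ ℤ` with
`a² + b² = q`. Let `L` be a field which is a `ℚ₂`-algebra of dimension 2 over `ℚ₂`,
`α ∈ L` with `α² = -1`, and `μ = a + b·α`. Then there exist `z, w ∈ L` with
`μ·w² = μ² - (p+q)·μ·z² + pq·z⁴` if and only if `p ≡ 7 (mod 8)` or `a ≡ 2 (mod 4)`. -/
theorem stmt_18 (p q : ℕ) (hp : p.Prime) (hq : q.Prime) (hpq : q = p + 2)
    (hp3 : p % 4 = 3) (a b : ℤ) (hab : a ^ 2 + b ^ 2 = (q : ℤ))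
    (L : Type*) [Field L] [Algebra ℚ_[2] L] (hdim : Module.finrank ℚ_[2] L = 2)
    (α : L) (hα : α ^ 2 = -1) (μ : L) (hμ : μ = (a : L) + (b : L) * α) :
    (∃ z w : L,
        μ * w ^ 2 = μ ^ 2 - ((p : L) + (q : L)) * μ * z ^ 2 + (p : L) * (q : L) * z ^ 4) ↔
      (p % 8 = 7 ∨ a % 4 = 2) := by
  subst hμ
  have hcz : CharZero L := charZero_of_injective_algebraMap (algebraMap ℚ_[2] L).injective
  have h2 : (2 : L) ≠ 0 := two_ne_zero
  have hq0 : (q : L) ≠ 0 := by exact_mod_cast hq.ne_zero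
  have hμ0 : (a : L) + (b : L) * α ≠ 0 := by
    intro h0
    apply hq0
    have : (a : L) ^ 2 + (b : L) ^ 2 = q := by exact_mod_cast congrArg (Int.cast : ℤ → L) hab
    rw [← this]
    linear_combination ((a : L) - b * α) * h0 + (b : L) ^ 2 * hα
  constructor
  · rintro ⟨z, w, h⟩
    by_contra hcon
    push Not at hcon
    obtain ⟨hp7, ha2⟩ := hcon
    have hp8 : p % 8 = 3 := by omega
    have hq8 : (a ^ 2 + b ^ 2) % 8 = 5 := by rw [hab]; omega
    have hab' : a % 2 = 1 ∧ b % 4 = 2 := by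
      have ha8 : a % 8 = 0 ∨ a % 8 = 1 ∨ a % 8 = 2 ∨ a % 8 = 3 ∨ a % 8 = 4 ∨ a % 8 = 5 ∨
        a % 8 = 6 ∨ a % 8 = 7 := by omega
      have hb8 : b % 8 = 0 ∨ b % 8 = 1 ∨ b % 8 = 2 ∨ b % 8 = 3 ∨ b % 8 = 4 ∨ b % 8 = 5 ∨
        b % 8 = 6 ∨ b % 8 = 7 := by omega
      rcases ha8 with h' | h' | h' | h' | h' | h' | h' | h' <;>
      rcases hb8 with h'' | h'' | h'' | h'' | h'' | h'' | h'' | h'' <;>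
      simp [pow_two, Int.add_emod, Int.mul_emod, h', h''] at hq8 <;> omega
    have hone : AuxInt L α 1 := ⟨1, 0, by simp⟩
    rcases aux_int_or L hdim α hα z with hz | ⟨hz0, hz⟩
    · exact aux_nonex p q hpq hp8 a b hab'.1 hab'.2 hab L hdim α hα z 1 w hz hone (Or.inr rfl)
        (by rw [h]; ring)
    · refine aux_nonex p q hpq hp8 a b hab'.1 hab'.2 hab L hdim α hα 1 z⁻¹ (w * (z⁻¹) ^ 2) hone hz
        (Or.inl rfl) ?_
      have e : z * z⁻¹ = 1 := mul_inv_cancel₀ hz0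
      have e2 : z ^ 2 * z⁻¹ ^ 2 = 1 := by rw [← mul_pow, e, one_pow]
      have e4 : z ^ 4 * z⁻¹ ^ 4 = 1 := by rw [← mul_pow, e, one_pow]
      linear_combination (z⁻¹) ^ 4 * h - ((p : L) + q) * (a + b * α) * z⁻¹ ^ 2 * e2 + p * q * e4
  · intro h
    have hdisj : a % 2 = 0 ∨ a % 2 = 1 := by omega
    rcases hdisj with ha | ha
    · obtain ⟨c, rfl⟩ : ∃ c, a = 2 * c := ⟨a / 2, by omega⟩
      obtain ⟨n, rfl⟩ : ∃ n, b = 2 * n + 1 := by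
        refine ⟨b / 2, ?_⟩
        by_contra hb
        obtain ⟨n, rfl⟩ : ∃ n, b = 2 * n := ⟨b / 2, by omega⟩
        ring_nf at hab
        omega
      obtain ⟨j, hj⟩ : ∃ j : ℕ, p = 4 * j + 3 := ⟨p / 4, by omega⟩
      subst hpq
      subst hj
      have := aux_exB L α hα c n j (by push_cast at hab; linarith) hμ0
      obtain ⟨z, w, h⟩ := this
      refine ⟨z, w, ?_⟩
      rw [h]
      push_cast
      ring
    · have hp7 : p % 8 = 7 := by omega
      obtain ⟨k, hk⟩ : ∃ j : ℕ, p = 8 * j + 7 := ⟨p / 8, by omega⟩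
      have hq8 : (a ^ 2 + b ^ 2) % 8 = 1 := by rw [hab]; omega
      obtain ⟨m, rfl⟩ : ∃ m, b = 4 * m := by
        refine ⟨b / 4, ?_⟩
        have ha8 : a % 8 = 1 ∨ a % 8 = 3 ∨ a % 8 = 5 ∨ a % 8 = 7 := by omega
        have hb8 : b % 8 = 0 ∨ b % 8 = 1 ∨ b % 8 = 2 ∨ b % 8 = 3 ∨ b % 8 = 4 ∨ b % 8 = 5 ∨
          b % 8 = 6 ∨ b % 8 = 7 := by omega
        rcases ha8 with h' | h' | h' | h' <;>
        rcases hb8 with h'' | h'' | h'' | h'' | h'' | h'' | h'' | h'' <;>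
        simp [pow_two, Int.add_emod, Int.mul_emod, h', h''] at hq8 <;> omega
      subst hpq
      subst hk
      obtain ⟨z, w, h⟩ := aux_exA L α hα a m k ha hμ0 h2
      refine ⟨z, w, ?_⟩
      rw [h]
      push_cast
      ring
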